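/- If B is a closed subset of a compact connected topological n-manifold Λ such that the complement Λ − B is disconnected, then the Lebesgue covering dimension of B is at least n − 1. -/

import Mathlib

open Set

/-- `CovDimLE X d` : the Lebesgue covering dimension of `X` is at most `d`, i.e. every
open cover of `X` has an open refinement in which no point lies in more than `d + 1`
sets. -/
def CovDimLE (X : Type*) [TopologicalSpace X] (d : ℕ) : Prop :=
  ∀ 𝒰 : Set (Set X), (∀ U ∈ 𝒰, IsOpen U) → ⋃₀ 𝒰 = univ →
    ∃ 𝒱 : Set (Set X), (∀ V ∈ 𝒱, IsOpen V) ∧ ⋃₀ 𝒱 = univ ∧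
      (∀ V ∈ 𝒱, ∃ U ∈ 𝒰, V ⊆ U) ∧
      ∀ x : X, { V ∈ 𝒱 | x ∈ V }.Finite ∧ { V ∈ 𝒱 | x ∈ V }.ncard ≤ d + 1

open MeasureTheory Filter Topology

section Degree

/-- The coordinatewise retraction of `ι → ℝ` onto the unit cube. -/
def cubeClamp {ι : Type*} (x : ι → ℝ) : ι → ℝ := fun i => max 0 (min 1 (x i))

theorem lipschitzWith_cubeClamp {ι : Type*} [Fintype ι] :
    LipschitzWith 1 (cubeClamp : (ι → ℝ) → ι → ℝ) := by
  refine LipschitzWith.of_dist_le_mul fun x y => ?_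
  rw [NNReal.coe_one, one_mul, dist_pi_le_iff dist_nonneg]
  intro i
  have h : LipschitzWith 1 fun s : ℝ => max 0 (min 1 s) :=
    (LipschitzWith.id.const_min 1).const_max 0
  simpa [cubeClamp] using (h.dist_le_mul (x i) (y i)).trans (by simpa using dist_le_pi_dist x y i)

theorem cubeClamp_mem {ι : Type*} (x : ι → ℝ) : cubeClamp x ∈ Icc (0 : ι → ℝ) 1 :=
  ⟨fun _ => le_max_left _ _, fun _ => max_le zero_le_one (min_le_left _ _)⟩

theorem cubeClamp_of_mem {ι : Type*} {x : ι → ℝ} (hx : x ∈ Icc (0 : ι → ℝ) 1) : cubeClamp x = x := by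
  funext i
  have h0 : 0 ≤ x i := hx.1 i
  have h1 : x i ≤ 1 := hx.2 i
  simp [cubeClamp, h0, h1]

variable {ι : Type*} [Fintype ι]

/-- The determinant of `1 + t • A`, a polynomial in `t`, is recovered at `t = 1` from its values at
more than `card ι` points by Lagrange interpolation. -/
theorem det_eq_sum_interpolation [DecidableEq ι] (s : Finset ℝ) (hs : Fintype.card ι < s.card)
    (A : (ι → ℝ) →L[ℝ] (ι → ℝ)) :
    (1 + A).det = ∑ t ∈ s, (1 + t • A).det * (Lagrange.basis s id t).eval 1 := by
  set M : Matrix ι ι ℝ := LinearMap.toMatrix' (A : (ι → ℝ) →ₗ[ℝ] (ι → ℝ)) with hM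
  set p : Polynomial ℝ :=
    ((Polynomial.X : Polynomial ℝ) • M.map Polynomial.C + (1 : Matrix ι ι ℝ).map Polynomial.C).det
    with hp
  have hev (t : ℝ) : p.eval t = (1 + t • A).det := by
    rw [hp, ← Polynomial.coe_evalRingHom, RingHom.map_det]
    have : (1 + t • A).det = (LinearMap.toMatrix' ((1 + t • A : (ι → ℝ) →L[ℝ] (ι → ℝ)) :
        (ι → ℝ) →ₗ[ℝ] (ι → ℝ))).det := by
      rw [LinearMap.det_toMatrix']
    rw [this]
    congr 1
    ext i j
    simp [hM, LinearMap.toMatrix'_apply, Matrix.one_apply, Pi.single_apply, add_comm, mul_comm t]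
    split_ifs <;> simp
  have hdeg : p.degree < s.card :=
    (Polynomial.degree_le_of_natDegree_le
      (Polynomial.natDegree_det_X_add_C_le M 1)).trans_lt (by exact_mod_cast hs)
  have h := Lagrange.eq_interpolate (s := s) (v := id) (injOn_id _) hdeg
  have h1 := congrArg (Polynomial.eval 1) h
  rw [Lagrange.interpolate_apply, Polynomial.eval_finsetSum] at h1
  simpa [hev] using h1

/-- A Lipschitz-small perturbation of the identity preserving the faces of the cube maps the cube
bijectively to itself. -/
theorem injOn_and_image_cube {F : (ι → ℝ) → ι → ℝ} {K : NNReal}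
    (hF : LipschitzOnWith K F (Icc 0 1)) (hmaps : MapsTo F (Icc 0 1) (Icc 0 1))
    (h0 : ∀ x ∈ Icc (0 : ι → ℝ) 1, ∀ i, x i = 0 → F x i = 0)
    (h1 : ∀ x ∈ Icc (0 : ι → ℝ) 1, ∀ i, x i = 1 → F x i = 1)
    {t : ℝ} (ht0 : 0 ≤ t) (ht1 : t ≤ 1) (ht : t * ((K : ℝ) + 1) < 1) :
    InjOn (fun x => x + t • (F x - x)) (Icc 0 1) ∧
      (fun x => x + t • (F x - x)) '' Icc 0 1 = Icc (0 : ι → ℝ) 1 := by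
  set f : (ι → ℝ) → ι → ℝ := fun x => x + t • (F (cubeClamp x) - cubeClamp x) with hf
  have hc : LipschitzWith (K + 1) fun x : ι → ℝ => F (cubeClamp x) - cubeClamp x := by
    have h2 : LipschitzWith (K * 1) fun x : ι → ℝ => F (cubeClamp x) := by
      rw [← lipschitzOnWith_univ]
      exact hF.comp lipschitzWith_cubeClamp.lipschitzOnWith fun x _ => cubeClamp_mem x
    simpa using h2.sub lipschitzWith_cubeClamp
  have happ : ApproximatesLinearOn f
      ((ContinuousLinearEquiv.refl ℝ (ι → ℝ) : (ι → ℝ) →L[ℝ] (ι → ℝ))) univ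
      (t.toNNReal * (K + 1)) := by
    intro x _ y _
    have := hc.dist_le_mul x y
    rw [dist_eq_norm, dist_eq_norm] at this
    have e : f x - f y - (ContinuousLinearEquiv.refl ℝ (ι → ℝ) : (ι → ℝ) →L[ℝ] (ι → ℝ)) (x - y)
        = t • ((F (cubeClamp x) - cubeClamp x) - (F (cubeClamp y) - cubeClamp y)) := by
      simp only [hf, ContinuousLinearEquiv.coe_coe, ContinuousLinearEquiv.coe_refl', id]
      module
    rw [e, norm_smul, Real.norm_of_nonneg ht0, NNReal.coe_mul, Real.coe_toNNReal _ ht0, mul_assoc]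
    exact mul_le_mul_of_nonneg_left this ht0
  have hsmall : Subsingleton (ι → ℝ) ∨ t.toNNReal * (K + 1) <
      ‖((ContinuousLinearEquiv.refl ℝ (ι → ℝ)).symm : (ι → ℝ) →L[ℝ] (ι → ℝ))‖₊⁻¹ := by
    rcases subsingleton_or_nontrivial (ι → ℝ) with h | h
    · exact Or.inl h
    · right
      have e1 : ‖((ContinuousLinearEquiv.refl ℝ (ι → ℝ)).symm : (ι → ℝ) →L[ℝ] (ι → ℝ))‖₊ = 1 :=
        NNReal.eq ContinuousLinearMap.norm_id
      rw [e1, inv_one, ← NNReal.coe_lt_coe]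
      simpa [Real.coe_toNNReal _ ht0] using ht
  have heq : EqOn (fun x => x + t • (F x - x)) f (Icc 0 1) := fun x hx => by
    simp [hf, cubeClamp_of_mem hx]
  have hinj := happ.injOn hsmall
  have hsurj := happ.surjective hsmall
  refine ⟨heq.injOn_iff.2 (hinj.mono (subset_univ _)), ?_⟩
  rw [heq.image_eq]
  refine Subset.antisymm ?_ fun y hy => ?_
  · rintro _ ⟨x, hx, rfl⟩
    have hFx := hmaps hx
    have := (convex_Icc (0 : ι → ℝ) 1) hx hFx (sub_nonneg.2 ht1) ht0 (by ring)
    convert this using 1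
    simp only [hf, cubeClamp_of_mem hx]
    module
  · obtain ⟨x, rfl⟩ := hsurj y
    refine ⟨x, ?_, rfl⟩
    constructor
    · intro i
      by_contra hneg
      have hneg : x i < 0 := not_le.1 hneg
      have hci : cubeClamp x i = 0 := by simp [cubeClamp, hneg.le]
      have hFi := h0 _ (cubeClamp_mem x) i hci
      have := hy.1 i
      simp [hf, hci, hFi] at this
      linarith
    · intro i
      by_contra hneg
      have hneg : 1 < x i := not_le.1 hneg
      have hci : cubeClamp x i = 1 := by simp [cubeClamp, hneg.le]
      have hFi := h1 _ (cubeClamp_mem x) i hci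
      have := hy.2 i
      simp [hf, hci, hFi] at this
      linarith

/-- A `C¹` self-map of the cube preserving its faces has Jacobian integral `1`. -/
theorem integral_det_fderiv_cube {F : (ι → ℝ) → ι → ℝ} (hF : ContDiff ℝ 1 F)
    (hmaps : MapsTo F (Icc 0 1) (Icc 0 1))
    (h0 : ∀ x ∈ Icc (0 : ι → ℝ) 1, ∀ i, x i = 0 → F x i = 0)
    (h1 : ∀ x ∈ Icc (0 : ι → ℝ) 1, ∀ i, x i = 1 → F x i = 1) :
    ∫ x in Icc (0 : ι → ℝ) 1, (fderiv ℝ F x).det = 1 := by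
  classical
  obtain ⟨K, hK⟩ := hF.contDiffOn.exists_lipschitzOnWith one_ne_zero
    (convex_Icc (0 : ι → ℝ) 1) isCompact_Icc
  have hvol : volume (Icc (0 : ι → ℝ) 1) = 1 := by simp [Real.volume_Icc_pi]
  have hD : Continuous fun x => fderiv ℝ F x := hF.continuous_fderiv one_ne_zero
  have hdet : Continuous fun z : ℝ × (ι → ℝ) => (1 + z.1 • (fderiv ℝ F z.2 - 1)).det := by
    have : Continuous fun z : ℝ × (ι → ℝ) => (1 + z.1 • (fderiv ℝ F z.2 - 1)) := by fun_prop
    exact ContinuousLinearMap.continuous_det.comp this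
  have hpos : ∀ᶠ t in 𝓝 (0 : ℝ), ∀ x ∈ Icc (0 : ι → ℝ) 1,
      0 < (1 + t • (fderiv ℝ F x - 1)).det := by
    refine isCompact_Icc.eventually_forall_of_forall_eventually fun x _ => ?_
    refine hdet.continuousAt.eventually (lt_mem_nhds ?_)
    simp [ContinuousLinearMap.det]
  have hsmall : ∀ᶠ t in 𝓝 (0 : ℝ), t * ((K : ℝ) + 1) < 1 ∧ t ≤ 1 := by
    refine Filter.Eventually.and ?_ (eventually_le_nhds one_pos)
    have : Continuous fun t : ℝ => t * ((K : ℝ) + 1) := by fun_prop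
    exact this.continuousAt.eventually (gt_mem_nhds (by simp))
  have hconst : ∀ᶠ t in 𝓝[>] (0 : ℝ),
      ∫ x in Icc (0 : ι → ℝ) 1, (1 + t • (fderiv ℝ F x - 1)).det = 1 := by
    filter_upwards [nhdsWithin_le_nhds hpos, nhdsWithin_le_nhds hsmall, self_mem_nhdsWithin]
      with t htpos ht ht0
    obtain ⟨hinj, himg⟩ := injOn_and_image_cube hK hmaps h0 h1 (le_of_lt ht0) ht.2 ht.1
    have hder : ∀ x ∈ Icc (0 : ι → ℝ) 1, HasFDerivWithinAt (fun x => x + t • (F x - x))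
        (1 + t • (fderiv ℝ F x - 1)) (Icc 0 1) x := fun x _ => by
      have hFx : HasFDerivAt F (fderiv ℝ F x) x :=
        (hF.differentiable one_ne_zero).differentiableAt.hasFDerivAt
      exact ((hasFDerivAt_id x).add ((hFx.sub (hasFDerivAt_id x)).const_smul t)).hasFDerivWithinAt
    have hcv := integral_image_eq_integral_abs_det_fderiv_smul volume measurableSet_Icc hder hinj
      (fun _ => (1 : ℝ))
    rw [himg] at hcv
    calc ∫ x in Icc (0 : ι → ℝ) 1, (1 + t • (fderiv ℝ F x - 1)).det
        = ∫ x in Icc (0 : ι → ℝ) 1, |(1 + t • (fderiv ℝ F x - 1)).det| • (1 : ℝ) :=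
          setIntegral_congr_fun measurableSet_Icc fun x hx => by
            simp [abs_of_pos (htpos x hx)]
      _ = 1 := by rw [← hcv]; simp [Measure.real, hvol]
  obtain ⟨u, hu, hut⟩ := mem_nhdsGT_iff_exists_Ioo_subset.1 hconst
  obtain ⟨s, hsT, hs⟩ := (Ioo_infinite (mem_Ioi.1 hu)).exists_subset_card_eq (Fintype.card ι + 1)
  replace hsT : ∀ t ∈ s, ∫ x in Icc (0 : ι → ℝ) 1, (1 + t • (fderiv ℝ F x - 1)).det = 1 :=
    fun t ht => hut (hsT ht)
  have hne : s.Nonempty := Finset.card_pos.1 (by omega)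
  calc ∫ x in Icc (0 : ι → ℝ) 1, (fderiv ℝ F x).det
      = ∫ x in Icc (0 : ι → ℝ) 1, ∑ t ∈ s,
          (1 + t • (fderiv ℝ F x - 1)).det * (Lagrange.basis s id t).eval 1 := by
        congr 1
        funext x
        rw [← det_eq_sum_interpolation s (by omega), add_sub_cancel]
    _ = ∑ t ∈ s, (Lagrange.basis s id t).eval 1 := by
        rw [integral_finsetSum]
        · refine Finset.sum_congr rfl fun t ht => ?_
          rw [integral_mul_const, hsT t ht, one_mul]
        · intro t _
          have : Continuous fun x : ι → ℝ => (1 + t • (fderiv ℝ F x - 1)).det :=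
            hdet.comp (Continuous.prodMk_right t)
          exact (this.mul_const _).continuousOn.integrableOn_compact isCompact_Icc
    _ = 1 := by
        rw [← Polynomial.eval_finsetSum, Lagrange.sum_basis (injOn_id _) hne, Polynomial.eval_one]

/-- A `C¹` map with nonpositive, respectively at least `1`, coordinates on opposite faces of the cube
sends some point of the cube into the open cube. -/
theorem exists_mem_cube_forall_mem_Ioo {g : (ι → ℝ) → ι → ℝ} (hg : ContDiff ℝ 1 g)
    (h0 : ∀ x ∈ Icc (0 : ι → ℝ) 1, ∀ i, x i = 0 → g x i ≤ 0)
    (h1 : ∀ x ∈ Icc (0 : ι → ℝ) 1, ∀ i, x i = 1 → 1 ≤ g x i) :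
    ∃ x ∈ Icc (0 : ι → ℝ) 1, ∀ i, g x i ∈ Ioo (0 : ℝ) 1 := by
  classical
  by_contra! hno
  set F : (ι → ℝ) → ι → ℝ := fun x i => Real.smoothTransition (g x i) with hFdef
  have hF : ContDiff ℝ 1 F := contDiff_pi.2 fun i =>
    Real.smoothTransition.contDiff.comp (contDiff_pi.1 hg i)
  have hint := integral_det_fderiv_cube hF
    (fun x _ => ⟨fun i => Real.smoothTransition.nonneg _, fun i => Real.smoothTransition.le_one _⟩)
    (fun x hx i hi => Real.smoothTransition.zero_of_nonpos (h0 x hx i hi))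
    (fun x hx i hi => Real.smoothTransition.one_of_one_le (h1 x hx i hi))
  have hzero : ∀ x ∈ Icc (0 : ι → ℝ) 1, (fderiv ℝ F x).det = 0 := by
    intro x hx
    obtain ⟨i, hi⟩ := hno x hx
    have hext : fderiv ℝ (fun y => F y i) x = 0 := by
      rcases le_or_gt (g x i) 0 with hle | hlt
      · refine IsLocalMin.fderiv_eq_zero (Eventually.of_forall fun y => ?_)
        simp only [hFdef, Real.smoothTransition.zero_of_nonpos hle]
        exact Real.smoothTransition.nonneg _
      · have hge : 1 ≤ g x i := not_lt.1 fun h => hi ⟨hlt, h⟩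
        refine IsLocalMax.fderiv_eq_zero (Eventually.of_forall fun y => ?_)
        simp only [hFdef, Real.smoothTransition.one_of_one_le hge]
        exact Real.smoothTransition.le_one _
    have hrow : ∀ v, fderiv ℝ F x v i = 0 := fun v => by
      have := fderiv_apply (hF.differentiable one_ne_zero x) i
      rw [hext] at this
      exact (DFunLike.congr_fun this v).symm
    rw [ContinuousLinearMap.det, ← LinearMap.det_toMatrix']
    exact Matrix.det_eq_zero_of_row_eq_zero i fun j => by
      rw [LinearMap.toMatrix'_apply]; exact hrow _
  rw [setIntegral_congr_fun measurableSet_Icc hzero] at hint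
  simp at hint

/-- The **Poincaré–Miranda theorem** on the unit cube. -/
theorem poincare_miranda {h : (ι → ℝ) → ι → ℝ} (hh : ContinuousOn h (Icc 0 1))
    (h0 : ∀ x ∈ Icc (0 : ι → ℝ) 1, ∀ i, x i = 0 → h x i < 0)
    (h1 : ∀ x ∈ Icc (0 : ι → ℝ) 1, ∀ i, x i = 1 → 0 < h x i) :
    ∃ x ∈ Icc (0 : ι → ℝ) 1, h x = 0 := by
  by_contra! hne
  have hface (c : ℝ) (i : ι) : IsCompact (Icc (0 : ι → ℝ) 1 ∩ {x | x i = c}) :=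
    isCompact_Icc.inter_right (isClosed_eq (continuous_apply i) continuous_const)
  have hcoord (i : ι) : ContinuousOn (fun x => h x i) (Icc 0 1) :=
    (continuous_apply i).comp_continuousOn hh
  have hev : ∀ᶠ δ in 𝓝[>] (0 : ℝ), (∀ x ∈ Icc (0 : ι → ℝ) 1, 2 * δ ≤ ‖h x‖) ∧
      (∀ i, ∀ x ∈ Icc (0 : ι → ℝ) 1 ∩ {x | x i = 0}, 2 * δ ≤ - h x i) ∧
      ∀ i, ∀ x ∈ Icc (0 : ι → ℝ) 1 ∩ {x | x i = 1}, 2 * δ ≤ h x i := by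
    have key {s : Set (ι → ℝ)} (hs : IsCompact s) {f : (ι → ℝ) → ℝ} (hf : ContinuousOn f s)
        (hpos : ∀ x ∈ s, 0 < f x) : ∀ᶠ δ in 𝓝[>] (0 : ℝ), ∀ x ∈ s, 2 * δ ≤ f x := by
      obtain ⟨a, ha, hle⟩ := hs.exists_forall_le' hf hpos
      filter_upwards [nhdsWithin_le_nhds (gt_mem_nhds (half_pos ha))] with δ hδ x hx
      linarith [hle x hx]
    refine (key isCompact_Icc hh.norm fun x hx => norm_pos_iff.2 (hne x hx)).and
      ((eventually_all.2 fun i => ?_).and (eventually_all.2 fun i => ?_))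
    · exact key (hface 0 i) ((hcoord i).mono inter_subset_left).neg
        fun x hx => neg_pos.2 (h0 x hx.1 i hx.2)
    · exact key (hface 1 i) ((hcoord i).mono inter_subset_left) fun x hx => h1 x hx.1 i hx.2
  obtain ⟨δ, ⟨hδn, hδ0, hδ1⟩, hδ⟩ := (hev.and self_mem_nhdsWithin).exists
  have hδ : 0 < δ := hδ
  have hcont : Continuous fun x => h (cubeClamp x) := by
    rw [← continuousOn_univ]
    exact hh.comp lipschitzWith_cubeClamp.continuous.continuousOn fun x _ => cubeClamp_mem x
  obtain ⟨g, hg⟩ := exists_contMDiffMap_forall_mem_convex_of_local_const (n := (1 : ℕ∞))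
    (modelWithCornersSelf ℝ (ι → ℝ))
    (t := fun x => Metric.ball (h (cubeClamp x)) δ) (fun x => convex_ball _ _)
    (fun x => ⟨h (cubeClamp x), by
      filter_upwards [hcont.continuousAt.eventually (Metric.ball_mem_nhds _ hδ)] with y hy
      exact Metric.mem_ball'.1 hy⟩)
  have hgd : ContDiff ℝ 1 g := g.contMDiff.contDiff
  have hclose : ∀ x ∈ Icc (0 : ι → ℝ) 1, ∀ i, |g x i - h x i| < δ := fun x hx i => by
    have := hg x
    rw [cubeClamp_of_mem hx, Metric.mem_ball, dist_eq_norm] at this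
    exact (norm_le_pi_norm (g x - h x) i).trans_lt this
  obtain ⟨x, hx, hxi⟩ := exists_mem_cube_forall_mem_Ioo
    (g := fun x i => (g x i / δ + 1) / 2)
    (contDiff_pi.2 fun i => (((contDiff_pi.1 hgd i).div_const δ).add contDiff_const).div_const 2)
    (fun x hx i hi => by
      have hc := (abs_lt.1 (hclose x hx i)).2
      have := hδ0 i x ⟨hx, hi⟩
      have : g x i / δ ≤ -1 := by rw [div_le_iff₀ hδ]; linarith
      linarith)
    (fun x hx i hi => by
      have hc := (abs_lt.1 (hclose x hx i)).1
      have := hδ1 i x ⟨hx, hi⟩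
      have : 1 ≤ g x i / δ := by rw [le_div_iff₀ hδ]; linarith
      linarith)
  refine absurd (hδn x hx) (not_le.2 ((pi_norm_lt_iff (by positivity)).2 fun i => ?_))
  obtain ⟨hl, hr⟩ := hxi i
  have hl' : -1 < g x i / δ := by linarith
  have hr' : g x i / δ < 1 := by linarith
  rw [lt_div_iff₀ hδ] at hl'
  rw [div_lt_iff₀ hδ] at hr'
  have hc := abs_lt.1 (hclose x hx i)
  exact abs_lt.2 ⟨by linarith, by linarith⟩

end Degree

section GeneralPosition

/-- Finitely many vectors of `ℝᵐ` can be perturbed so that any `m` of them are independent. -/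
theorem exists_linearIndepOn_near {ι : Type*} [Fintype ι] {m : ℕ} (c : ι → Fin m → ℝ)
    {ε : ℝ} (hε : 0 < ε) :
    ∃ v : ι → Fin m → ℝ, (∀ i, dist (v i) (c i) < ε) ∧
      ∀ s : Finset ι, s.card ≤ m → LinearIndepOn ℝ v (s : Set ι) := by
  classical
  suffices H : ∀ T : Finset ι, ∃ v : ι → Fin m → ℝ, (∀ i, dist (v i) (c i) < ε) ∧
      ∀ s ⊆ T, s.card ≤ m → LinearIndepOn ℝ v (s : Set ι) by
    obtain ⟨v, hv, hs⟩ := H Finset.univ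
    exact ⟨v, hv, fun s => hs s (Finset.subset_univ s)⟩
  intro T
  induction T using Finset.induction_on with
  | empty =>
    refine ⟨c, fun i => by simpa using hε, fun s hs _ => ?_⟩
    rw [Finset.subset_empty.1 hs, Finset.coe_empty]
    exact linearIndepOn_empty ℝ c
  | insert a T ha ih =>
    obtain ⟨v, hv, hind⟩ := ih
    set bad : Set (Fin m → ℝ) := ⋃ s ∈ T.powerset.filter fun s => s.card < m,
      (Submodule.span ℝ (v '' (s : Set ι)) : Set (Fin m → ℝ)) with hbad
    have hnull : volume bad = 0 := by
      refine (measure_biUnion_null_iff (Finset.countable_toSet _)).2 fun s hs => ?_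
      refine Measure.addHaar_submodule _ _ fun htop => ?_
      have hcard : s.card < m := (Finset.mem_filter.1 hs).2
      have h1 : Module.finrank ℝ (Submodule.span ℝ (v '' (s : Set ι))) ≤ s.card := by
        rw [← Finset.coe_image]
        exact (finrank_span_finset_le_card _).trans Finset.card_image_le
      rw [htop, finrank_top, Module.finrank_fin_fun] at h1
      omega
    obtain ⟨y, hy, hyb⟩ : (Metric.ball (c a) ε \ bad).Nonempty := by
      rw [nonempty_iff_ne_empty]
      intro hempty
      have := measure_mono_null (sdiff_eq_empty.1 hempty) hnull
      exact (Metric.measure_ball_pos volume (c a) hε).ne' this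
    refine ⟨Function.update v a y, fun i => ?_, fun s hs hcard => ?_⟩
    · rcases eq_or_ne i a with rfl | hne
      · simpa using hy
      · simpa [hne] using hv i
    · have hcongr (r : Finset ι) (har : a ∉ r) :
          EqOn (Function.update v a y) v (r : Set ι) := fun i hi =>
        Function.update_of_ne (by rintro rfl; exact har hi) _ _
      have hindr (r : Finset ι) (har : a ∉ r) (hr : r ⊆ T) (hc : r.card ≤ m) :
          LinearIndepOn ℝ (Function.update v a y) (r : Set ι) := by
        have e : (fun i : (r : Set ι) => Function.update v a y i) = fun i : (r : Set ι) => v i :=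
          funext fun i => hcongr r har i.2
        rw [LinearIndepOn, e]
        exact hind r hr hc
      by_cases has : a ∈ s
      · have hsub : s.erase a ⊆ T := fun i hi =>
          (Finset.mem_insert.1 (hs (Finset.mem_of_mem_erase hi))).resolve_left
            (Finset.ne_of_mem_erase hi)
        have hlt : (s.erase a).card < m := (Finset.card_erase_lt_of_mem has).trans_le hcard
        rw [← Finset.insert_erase has, Finset.coe_insert]
        refine (hindr _ (Finset.notMem_erase a s) hsub hlt.le).insert ?_
        rw [Function.update_self, (hcongr _ (Finset.notMem_erase a s)).image_eq]
        exact fun hmem => hyb (mem_biUnion (Finset.mem_coe.2 (Finset.mem_filter.2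
          ⟨Finset.mem_powerset.2 hsub, hlt⟩)) hmem)
      · exact hindr s has (fun i hi => (Finset.mem_insert.1 (hs hi)).resolve_left
          fun h => has (h ▸ hi)) hcard

/-- A map from a compact space of covering dimension less than `m` to `ℝᵐ` can be perturbed off
the origin. -/
theorem CovDimLE.exists_near_forall_ne_zero {K : Type*} [TopologicalSpace K] [CompactSpace K]
    [T2Space K] {d m : ℕ} (hK : CovDimLE K d) (hdm : d + 1 ≤ m) (u : C(K, Fin m → ℝ))
    {ε : ℝ} (hε : 0 < ε) :
    ∃ g : C(K, Fin m → ℝ), ∀ x, dist (g x) (u x) < ε ∧ g x ≠ 0 := by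
  classical
  obtain ⟨𝒱, hVo, hVc, hVr, hVd⟩ := hK (range fun c => u ⁻¹' Metric.ball c (ε / 2))
    (forall_mem_range.2 fun c => Metric.isOpen_ball.preimage u.continuous)
    (eq_univ_of_forall fun x => ⟨_, mem_range_self (u x), Metric.mem_ball_self (half_pos hε)⟩)
  obtain ⟨T, hT𝒱, hTfin, hTc⟩ := isCompact_univ.elim_finite_subcover_image (c := id) hVo
    (by rw [← hVc, sUnion_eq_biUnion]; rfl)
  have : Fintype T := hTfin.fintype
  choose c hc using fun V : T => by simpa using hVr V (hT𝒱 V.2)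
  obtain ⟨v, hv, hind⟩ := exists_linearIndepOn_near c (half_pos hε)
  obtain ⟨f, hf⟩ := PartitionOfUnity.exists_isSubordinate isClosed_univ
    (fun V : T => (V : Set K)) (fun V => hVo V (hT𝒱 V.2)) (by rwa [biUnion_eq_iUnion] at hTc)
  have hsum (x : K) : ∑ V, f V x = 1 := by
    rw [← finsum_eq_sum_of_fintype]
    exact f.sum_eq_one (mem_univ x)
  have hmem {V : T} {x : K} (h : f V x ≠ 0) : x ∈ (V : Set K) :=
    hf V (subset_tsupport _ h)
  refine ⟨⟨fun x => ∑ V, f V x • v V, by fun_prop⟩, fun x => ⟨?_, fun hzero => ?_⟩⟩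
  · change ∑ V, f V x • v V ∈ Metric.ball (u x) ε
    rw [← finsum_eq_sum_of_fintype]
    refine f.finsum_smul_mem_convex (g := fun V _ => v V) (mem_univ x) (fun V hV => ?_)
      (convex_ball _ _)
    have h1 : dist (u x) (c V) < ε / 2 := hc V (hmem hV)
    have h2 := dist_triangle_right (v V) (u x) (c V)
    exact Metric.mem_ball.2 (by linarith [hv V])
  · set s : Finset T := Finset.univ.filter fun V => f V x ≠ 0 with hs
    have hcard : s.card ≤ m := by
      refine le_trans ?_ ((hVd x).2.trans hdm)
      rw [← Finset.card_map (Function.Embedding.subtype _), ← ncard_coe_finset]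
      refine ncard_le_ncard (fun V hV => ?_) (hVd x).1
      obtain ⟨W, hW, rfl⟩ := Finset.mem_map.1 hV
      exact ⟨hT𝒱 W.2, hmem (Finset.mem_filter.1 hW).2⟩
    have hss : ∑ V ∈ s, f V x • v V = 0 := by
      rw [hs, Finset.sum_filter_of_ne]
      · exact hzero
      · intro V _ h h0
        exact h (by rw [h0, zero_smul])
    have hall := linearIndepOn_finset_iff.1 (hind s hcard) (fun V => f V x) hss
    have hz : ∀ V, f V x = 0 := fun V => by
      by_contra h
      exact h (hall V (Finset.mem_filter.2 ⟨Finset.mem_univ V, h⟩))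
    simpa [hz] using hsum x

end GeneralPosition

section Separation

/-- In a compact Hausdorff space, a closed set containing the complement of two disjoint open sets
which contain opposite faces of an embedded `(m + 1)`-cube has covering dimension at least `m`. -/
theorem not_covDimLE_of_separates_faces {Λ : Type*} [TopologicalSpace Λ] [CompactSpace Λ]
    [T2Space Λ] {B U W : Set Λ} (hB : IsClosed B) (hU : IsOpen U) (hW : IsOpen W)
    (hUW : Disjoint U W) (hcompl : (U ∪ W)ᶜ ⊆ B) {m : ℕ} {γ : (Fin (m + 1) → ℝ) → Λ}
    (hγ : ContinuousOn γ (Icc 0 1)) (hinj : InjOn γ (Icc 0 1))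
    (h0 : ∀ x ∈ Icc (0 : Fin (m + 1) → ℝ) 1, x 0 = 0 → γ x ∈ U)
    (h1 : ∀ x ∈ Icc (0 : Fin (m + 1) → ℝ) 1, x 0 = 1 → γ x ∈ W)
    {d : ℕ} (hd : d + 1 ≤ m) : ¬ CovDimLE B d := by
  intro hdim
  let Q := Icc (0 : Fin (m + 1) → ℝ) 1
  have : CompactSpace Q := isCompact_iff_compactSpace.1 isCompact_Icc
  have : CompactSpace B := isCompact_iff_compactSpace.1 hB.isCompact
  let Γ : C(Q, Λ) := ⟨Q.domRestrict γ, hγ.domRestrict⟩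
  have hΓ : IsClosedEmbedding Γ :=
    Γ.continuous.isClosedEmbedding (injOn_iff_injective.1 hinj)
  let p : C(Q, Fin m → ℝ) := ⟨fun x i => x.1 i.succ - 1 / 2, continuous_pi fun i =>
    ((continuous_apply i.succ).comp continuous_subtype_val).sub continuous_const⟩
  obtain ⟨u, hu⟩ := ContinuousMap.exists_extension hΓ p
  have hu' (x : Q) (i : Fin m) : u (Γ x) i = x.1 i.succ - 1 / 2 :=
    congrFun (DFunLike.congr_fun hu x) i
  obtain ⟨g, hg⟩ := hdim.exists_near_forall_ne_zero hd (u.restrict B)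
    (show (0 : ℝ) < 1 / 4 by norm_num)
  have hext (i : Fin m) : ∃ w : C(Λ, ℝ), (∀ y, w y ∈ Icc (-(1 / 4) : ℝ) (1 / 4)) ∧
      ∀ y : B, w y = g y i - u y i := by
    let q : C(B, ℝ) := ⟨fun y => g y i - u y i, by fun_prop⟩
    have hq (y : B) : q y ∈ Icc (-(1 / 4) : ℝ) (1 / 4) := by
      have h := (dist_le_pi_dist (g y) (u.restrict B y) i).trans (hg y).1.le
      rw [Real.dist_eq] at h
      exact abs_le.1 h
    obtain ⟨w, hw, hwq⟩ :=
      q.exists_restrict_eq_forall_mem_of_closed hq ⟨0, by norm_num⟩ hB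
    exact ⟨w, hw, fun y => DFunLike.congr_fun hwq y⟩
  choose w hw hwB using hext
  have hsub0 : (0 : Fin (m + 1) → ℝ) ∈ Q := ⟨le_rfl, zero_le_one⟩
  have hsub1 : (1 : Fin (m + 1) → ℝ) ∈ Q := ⟨zero_le_one, le_rfl⟩
  have hdisj {y : Λ} (hyU : y ∈ U) (hyW : y ∈ W) : False :=
    disjoint_left.1 hUW hyU hyW
  let k : Q → ℝ := fun x =>
    Metric.infDist x (Γ ⁻¹' W)ᶜ - Metric.infDist x (Γ ⁻¹' U)ᶜ
  have hk : Continuous k := (Metric.continuous_infDist_pt _).sub (Metric.continuous_infDist_pt _)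
  have hpos {V : Set Λ} (hV : IsOpen V) {x₀ : Q} (hx₀ : Γ x₀ ∉ V) {x : Q} (hx : Γ x ∈ V) :
      0 < Metric.infDist x (Γ ⁻¹' V)ᶜ :=
    ((hV.preimage Γ.continuous).isClosed_compl.notMem_iff_infDist_pos ⟨x₀, hx₀⟩).1
      (not_not.2 hx)
  have hkU {x : Q} (hx : Γ x ∈ U) : k x < 0 := by
    have e : Metric.infDist x (Γ ⁻¹' W)ᶜ = 0 := Metric.infDist_zero_of_mem fun h => hdisj hx h
    have := hpos hU (x₀ := ⟨1, hsub1⟩) (fun h => hdisj h (h1 1 hsub1 rfl)) hx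
    simp only [k, e]
    linarith
  have hkW {x : Q} (hx : Γ x ∈ W) : 0 < k x := by
    have e : Metric.infDist x (Γ ⁻¹' U)ᶜ = 0 := Metric.infDist_zero_of_mem fun h => hdisj h hx
    have := hpos hW (x₀ := ⟨0, hsub0⟩) (fun h => hdisj (h0 0 hsub0 rfl) h) hx
    simp only [k, e]
    linarith
  let c : (Fin (m + 1) → ℝ) → Q := fun x => ⟨cubeClamp x, cubeClamp_mem x⟩
  have hc : Continuous c := lipschitzWith_cubeClamp.continuous.subtype_mk _
  have hcQ {x : Fin (m + 1) → ℝ} (hx : x ∈ Q) : c x = ⟨x, hx⟩ :=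
    Subtype.ext (cubeClamp_of_mem hx)
  let h : (Fin (m + 1) → ℝ) → Fin (m + 1) → ℝ := fun x =>
    Fin.cons (k (c x)) fun i => u (Γ (c x)) i + w i (Γ (c x))
  have hh : Continuous h := by
    refine continuous_pi fun i => ?_
    induction i using Fin.cases with
    | zero => exact hk.comp hc
    | succ i =>
      have e1 : Continuous fun x => u (Γ (c x)) i :=
        (continuous_apply i).comp (u.continuous.comp (Γ.continuous.comp hc))
      exact e1.add ((w i).continuous.comp (Γ.continuous.comp hc))
  obtain ⟨x, hx, hx0⟩ := poincare_miranda hh.continuousOn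
    (fun x hx i hi => by
      induction i using Fin.cases with
      | zero =>
        change k (c x) < 0
        rw [hcQ hx]
        exact hkU (h0 x hx hi)
      | succ i =>
        change u (Γ (c x)) i + w i (Γ (c x)) < 0
        rw [hcQ hx, hu']
        have := (hw i (Γ ⟨x, hx⟩)).2
        simp only [hi]
        linarith)
    (fun x hx i hi => by
      induction i using Fin.cases with
      | zero =>
        change 0 < k (c x)
        rw [hcQ hx]
        exact hkW (h1 x hx hi)
      | succ i =>
        change 0 < u (Γ (c x)) i + w i (Γ (c x))
        rw [hcQ hx, hu']
        have := (hw i (Γ ⟨x, hx⟩)).1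
        simp only [hi]
        linarith)
  have hk0 : k ⟨x, hx⟩ = 0 := by
    rw [← hcQ hx]
    exact congrFun hx0 0
  have hxB : Γ ⟨x, hx⟩ ∈ B := hcompl fun hmem =>
    hmem.elim (fun hm => (hkU hm).ne hk0) fun hm => (hkW hm).ne' hk0
  refine (hg ⟨_, hxB⟩).2 (funext fun i => ?_)
  have e : u (Γ (c x)) i + w i (Γ (c x)) = 0 := congrFun hx0 i.succ
  rw [hcQ hx, hwB i ⟨_, hxB⟩] at e
  simpa using e

/-- Two distinct points of an open convex set, with given neighbourhoods, are joined by a thin box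
contained in the convex set whose ends lie in these neighbourhoods. -/
theorem exists_thin_box {m : ℕ} {E : Type*} [NormedAddCommGroup E] [NormedSpace ℝ E]
    (L₀ : (Fin (m + 1) → ℝ) ≃L[ℝ] E) {S O₀ O₁ : Set E} (hS : IsOpen S) (hSc : Convex ℝ S)
    (hO₀ : IsOpen O₀) (hO₁ : IsOpen O₁) {p q : E} (hp : p ∈ S ∩ O₀) (hq : q ∈ S ∩ O₁)
    (hpq : p ≠ q) :
    ∃ κ : (Fin (m + 1) → ℝ) → E, Continuous κ ∧ Function.Injective κ ∧
      MapsTo κ (Icc 0 1) S ∧ (∀ x ∈ Icc (0 : Fin (m + 1) → ℝ) 1, x 0 = 0 → κ x ∈ O₀) ∧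
      ∀ x ∈ Icc (0 : Fin (m + 1) → ℝ) 1, x 0 = 1 → κ x ∈ O₁ := by
  have he : (Pi.single 0 1 : Fin (m + 1) → ℝ) ≠ 0 := by simp
  have hv : L₀.symm (q - p) ≠ 0 := by simpa [sub_eq_zero] using hpq.symm
  obtain ⟨A, hA⟩ := SeparatingDual.exists_continuousLinearEquiv_apply_eq (R := ℝ) he hv
  let L := A.trans L₀
  have hL : L (Pi.single 0 1) = q - p := by simp [L, hA]
  let κ : ℝ → (Fin (m + 1) → ℝ) → E := fun ε x =>
    p + L (Fin.cons (x 0) fun i => ε * x i.succ)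
  have hκ : Continuous fun z : ℝ × (Fin (m + 1) → ℝ) => κ z.1 z.2 := by
    refine continuous_const.add (L.continuous.comp (continuous_pi fun i => ?_))
    induction i using Fin.cases with
    | zero => simp only [Fin.cons_zero]; fun_prop
    | succ i => simp only [Fin.cons_succ]; fun_prop
  have hκ0 (x : Fin (m + 1) → ℝ) : κ 0 x = p + x 0 • (q - p) := by
    have : (Fin.cons (x 0) fun i : Fin m => 0 * x i.succ : Fin (m + 1) → ℝ) =
        x 0 • Pi.single 0 1 := by
      funext i
      induction i using Fin.cases with
      | zero => simp
      | succ i => simp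
    simp only [κ, this, map_smul, hL]
  have hev : ∀ᶠ ε in 𝓝 (0 : ℝ), ∀ x ∈ Icc (0 : Fin (m + 1) → ℝ) 1,
      κ ε x ∈ S ∧ (x 0 = 0 → κ ε x ∈ O₀) ∧ (x 0 = 1 → κ ε x ∈ O₁) := by
    refine isCompact_Icc.eventually_forall_of_forall_eventually fun x hx => ?_
    have hnear {O : Set E} (hO : IsOpen O) (hxO : κ 0 x ∈ O) :
        ∀ᶠ z : ℝ × (Fin (m + 1) → ℝ) in 𝓝 (0, x), κ z.1 z.2 ∈ O :=
      hκ.continuousAt.eventually (hO.mem_nhds hxO)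
    have hend (c : ℝ) {O : Set E} (hO : IsOpen O) (hcO : p + c • (q - p) ∈ O) :
        ∀ᶠ z : ℝ × (Fin (m + 1) → ℝ) in 𝓝 (0, x), z.2 0 = c → κ z.1 z.2 ∈ O := by
      rcases eq_or_ne (x 0) c with hxc | hxc
      · exact (hnear hO (by rwa [hκ0, hxc])).mono fun z hz _ => hz
      · have hcont : Continuous fun z : ℝ × (Fin (m + 1) → ℝ) => z.2 0 := by fun_prop
        exact (hcont.continuousAt.eventually_ne (x := (0, x)) hxc).mono
          fun z hz hzc => absurd hzc hz
    refine (hnear hS ?_).and ((hend 0 hO₀ ?_).and (hend 1 hO₁ ?_))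
    · rw [hκ0]
      exact hSc.add_smul_sub_mem hp.1 hq.1 ⟨hx.1 0, hx.2 0⟩
    · simpa using hp.2
    · simpa using hq.2
  obtain ⟨ε, hε, hpos⟩ := ((hev.filter_mono nhdsWithin_le_nhds).and
    (self_mem_nhdsWithin : ∀ᶠ ε in 𝓝[>] (0 : ℝ), 0 < ε)).exists
  refine ⟨κ ε, hκ.comp (Continuous.prodMk_right ε), fun x y hxy => ?_, fun x hx => (hε x hx).1,
    fun x hx => (hε x hx).2.1, fun x hx => (hε x hx).2.2⟩
  obtain ⟨hfst, hsnd⟩ := Fin.cons_inj.1 (L.injective (add_left_cancel hxy))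
  funext i
  induction i using Fin.cases with
  | zero => exact hfst
  | succ i => exact mul_left_cancel₀ hpos.ne' (congrFun hsnd i)

end Separation

/-- If `B` is a closed subset of a compact connected topological
`n`-manifold `Λ` such that `Λ − B` is disconnected, then the Lebesgue covering
dimension of `B` is at least `n − 1` (i.e. `CovDimLE B d` forces `n - 1 ≤ d`). -/
theorem dim_ge_of_disconnecting
    (n : ℕ) (Λ : Type*) [TopologicalSpace Λ] [CompactSpace Λ] [ConnectedSpace Λ]
    [T2Space Λ] [ChartedSpace (EuclideanSpace ℝ (Fin n)) Λ]
    (B : Set Λ) (hB : IsClosed B) (hdisc : ¬ IsPreconnected Bᶜ) :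
    ∀ d : ℕ, CovDimLE B d → n - 1 ≤ d := by
  intro d hd
  by_contra! hlt
  obtain ⟨m, rfl⟩ : ∃ m, n = m + 1 := ⟨n - 1, by omega⟩
  have hsep : ∃ U V : Set Λ, IsOpen U ∧ IsOpen V ∧ U.Nonempty ∧ V.Nonempty ∧ Disjoint U V ∧
      Bᶜ ⊆ U ∪ V := by
    simp only [IsPreconnected, not_forall] at hdisc
    obtain ⟨U, V, hU, hV, hUV, hneU, hneV, hne⟩ := hdisc
    refine ⟨Bᶜ ∩ U, Bᶜ ∩ V, hB.isOpen_compl.inter hU, hB.isOpen_compl.inter hV, hneU, hneV, ?_,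
      fun x hx => (hUV hx).imp (fun h => ⟨hx, h⟩) fun h => ⟨hx, h⟩⟩
    exact disjoint_left.2 fun x hxU hxV => hne ⟨x, hxU.1, hxU.2, hxV.2⟩
  obtain ⟨U, V, hU, hV, hneU, hneV, hUV, hcov⟩ := hsep
  have hVcl : Disjoint (closure U) V := hUV.closure_left hV
  obtain ⟨x, hx⟩ : (frontier (closure U)).Nonempty := by
    rw [nonempty_iff_ne_empty, Ne, ← isClopen_iff_frontier_eq_empty, isClopen_iff]
    rintro (h | h)
    · exact hneU.closure.ne_empty h
    · obtain ⟨v, hv⟩ := hneV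
      exact disjoint_left.1 hVcl (h ▸ mem_univ v) hv
  let e := chartAt (EuclideanSpace ℝ (Fin (m + 1))) x
  have hxs : x ∈ e.source := mem_chart_source _ x
  obtain ⟨r, hr, hball⟩ := Metric.isOpen_iff.1 e.open_target (e x) (e.map_source hxs)
  let N := e.source ∩ e ⁻¹' Metric.ball (e x) r
  have hN : IsOpen N := e.isOpen_inter_preimage Metric.isOpen_ball
  have hxN : x ∈ N := ⟨hxs, Metric.mem_ball_self hr⟩
  obtain ⟨a, haN, haU⟩ : (N ∩ U).Nonempty :=
    mem_closure_iff.1 (isClosed_closure.frontier_subset hx) N hN hxN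
  obtain ⟨b, hbN, hbU⟩ : (N ∩ (closure U)ᶜ).Nonempty := by
    rw [frontier_eq_closure_inter_closure] at hx
    exact mem_closure_iff.1 hx.2 N hN hxN
  have hab : e a ≠ e b := fun h =>
    hbU (e.injOn haN.1 hbN.1 h ▸ subset_closure haU)
  obtain ⟨κ, hκc, hκi, hκS, hκ0, hκ1⟩ := exists_thin_box
    (EuclideanSpace.equiv (Fin (m + 1)) ℝ).symm (Metric.isOpen_ball (x := e x) (ε := r))
    (convex_ball _ _) (e.isOpen_inter_preimage_symm hU)
    (e.isOpen_inter_preimage_symm isClosed_closure.isOpen_compl)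
    (p := e a) (q := e b) ⟨haN.2, e.map_source haN.1, by simpa [e.left_inv haN.1] using haU⟩
    ⟨hbN.2, e.map_source hbN.1, by simpa [e.left_inv hbN.1] using hbU⟩ hab
  have hκt : MapsTo κ (Icc 0 1) e.target := fun y hy => hball (hκS hy)
  refine not_covDimLE_of_separates_faces hB hU isClosed_closure.isOpen_compl
    (disjoint_compl_right.mono_left subset_closure) ?_ (γ := e.symm ∘ κ)
    (e.continuousOn_symm.comp hκc.continuousOn hκt)
    (e.symm.injOn.comp hκi.injOn hκt) (fun y hy h => (hκ0 y hy h).2)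
    (fun y hy h => (hκ1 y hy h).2) (by omega) hd
  intro y hy
  by_contra hyB
  have hycl : y ∈ closure U := not_not.1 fun h => hy (Or.inr h)
  exact (hcov hyB).elim (fun h => hy (Or.inl h)) (disjoint_left.1 hVcl hycl)
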